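/- Fix δ ∈ (0,1) and the channel W, and set K_δ = ⌈(log₂|𝒴|)/δ⌉. There exist sequences ε_n ≥ 0 with ε_n → 0 and β_n ∈ (0,1) with β_n → 1, not depending on the input set, such that for all sufficiently large n and every nonempty A ⊆ 𝒳ⁿ there exists a nonempty A* ⊆ A satisfying |A*|/|A| ≥ 1/(2(K_δ+1)) and (1/n)·H(P_{A*}) ≥ (1/n)·log₂ gⁿ(A*, β_n) − 7.19·δ − ε_n. -/

import Mathlib

open scoped BigOperators Classical
open Finset Real

noncomputable section

/-- The `n`-fold product channel: `Wⁿ(yⁿ|xⁿ) = ∏ⱼ W(yⱼ|xⱼ)`. -/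
def prodW {X Y : Type*} (W : X → Y → ℝ) {n : ℕ} (x : Fin n → X) (y : Fin n → Y) : ℝ :=
  ∏ j, W (x j) (y j)

/-- Probability `Wⁿ(B|xⁿ)` of an output set `B` given input `xⁿ`. -/
def prodWSet {X Y : Type*} (W : X → Y → ℝ) {n : ℕ} (x : Fin n → X)
    (B : Finset (Fin n → Y)) : ℝ :=
  ∑ y ∈ B, prodW W x y

/-- Output distribution `P_A` of `Wⁿ` with uniformly distributed input on `A`. -/
def outDist {X Y : Type*} (W : X → Y → ℝ) {n : ℕ}
    (A : Finset (Fin n → X)) (y : Fin n → Y) : ℝ :=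
  (A.card : ℝ)⁻¹ * ∑ x ∈ A, prodW W x y

/-- `W` is a channel: each row is a probability distribution on `Y`. -/
def isChannel {X Y : Type*} [Fintype Y] (W : X → Y → ℝ) : Prop :=
  ∀ x, (∀ y, 0 ≤ W x y) ∧ ∑ y, W x y = 1

/-- `K_δ = ⌈(log₂ |𝒴|)/δ⌉`. -/
def Kdel (c : ℕ) (δ : ℝ) : ℕ := ⌈Real.logb 2 c / δ⌉₊

/-- The sets `B_k` of the `δ`-information-spectrum partition of `𝒴ⁿ` w.r.t. the
information spectrum `i_n(yⁿ) = -(1/n) log₂ p(yⁿ)`:  membership `kδ ≤ i_n(yⁿ) < (k+1)δ`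
(resp. `Kδ ≤ i_n(yⁿ) < ∞` for `k = K`) is expressed directly in terms of `p`. -/
def specSet {Y : Type*} [Fintype Y] {n : ℕ} (p : (Fin n → Y) → ℝ)
    (δ : ℝ) (K k : ℕ) : Finset (Fin n → Y) :=
  if k < K then
    Finset.univ.filter fun y =>
      (2:ℝ) ^ (-((n:ℝ) * ((k:ℝ)+1) * δ)) < p y ∧ p y ≤ (2:ℝ) ^ (-((n:ℝ) * (k:ℝ) * δ))
  else
    Finset.univ.filter fun y => 0 < p y ∧ p y ≤ (2:ℝ) ^ (-((n:ℝ) * (K:ℝ) * δ))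

/-- `ḡⁿ(A,η)`: minimum cardinality of an `η`-quasi-image of `A` over `Wⁿ`. -/
def gbar {X Y : Type*} [Fintype Y] (W : X → Y → ℝ) {n : ℕ}
    (A : Finset (Fin n → X)) (η : ℝ) : ℕ :=
  sInf {m | ∃ B : Finset (Fin n → Y), B.card = m ∧ η ≤ ∑ y ∈ B, outDist W A y}

/-- `gⁿ(A,η)`: minimum cardinality of an `η`-image of `A` over `Wⁿ`. -/
def gimg {X Y : Type*} [Fintype Y] (W : X → Y → ℝ) {n : ℕ}
    (A : Finset (Fin n → X)) (η : ℝ) : ℕ :=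
  sInf {m | ∃ B : Finset (Fin n → Y), B.card = m ∧ ∀ x ∈ A, η ≤ prodWSet W x B}

/-- Shannon entropy (base 2) of a distribution `q` on a finite set. -/
def ent {Z : Type*} [Fintype Z] (q : Z → ℝ) : ℝ :=
  -∑ z, q z * Real.logb 2 (q z)

end

section Concentration

variable {Y : Type*} [Fintype Y]

/-- The second moment of a function with oscillation at most `1` exceeds its squared mean by at
most `1`. -/
theorem sum_mul_sq_le_sq_add_one (q : Y → ℝ) (hq : ∀ y, 0 ≤ q y) (hs : ∑ y, q y = 1)
    (h : Y → ℝ) (hh : ∀ a b, |h a - h b| ≤ 1) :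
    ∑ a, q a * h a ^ 2 ≤ (∑ a, q a * h a) ^ 2 + 1 := by
  set m := ∑ a, q a * h a with hm
  have key : ∀ a, (h a - m) ^ 2 ≤ 1 := by
    intro a
    have e : h a - m = ∑ b, q b * (h a - h b) := by
      simp only [mul_sub, Finset.sum_sub_distrib, ← Finset.sum_mul, hs, one_mul, hm]
    have : |h a - m| ≤ 1 := by
      rw [e]
      calc |∑ b, q b * (h a - h b)| ≤ ∑ b, |q b * (h a - h b)| := Finset.abs_sum_le_sum_abs _ _
        _ ≤ ∑ b, q b := by
          refine Finset.sum_le_sum fun b _ => ?_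
          rw [abs_mul, abs_of_nonneg (hq b)]
          exact mul_le_of_le_one_right (hq b) (hh a b)
        _ = 1 := hs
    exact (sq_le_one_iff_abs_le_one _).2 this
  have h1 : ∑ a, q a * (h a - m) ^ 2 ≤ 1 := by
    rw [← hs]
    exact Finset.sum_le_sum fun a _ => mul_le_of_le_one_right (hq a) (key a)
  have h2 : ∑ a, q a * (h a - m) ^ 2 = ∑ a, q a * h a ^ 2 - m ^ 2 := by
    have : ∀ a, q a * (h a - m) ^ 2 = q a * h a ^ 2 - 2 * m * (q a * h a) + m ^ 2 * q a := by
      intro a; ring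
    simp only [this, Finset.sum_add_distrib, Finset.sum_sub_distrib, ← Finset.mul_sum, hs, ← hm]
    ring
  linarith

theorem sum_fin_succ_eq_sum_cons {n : ℕ} (F : (Fin (n + 1) → Y) → ℝ) :
    ∑ y, F y = ∑ z : Fin n → Y, ∑ a : Y, F (Fin.cons a z) := by
  rw [Finset.sum_comm, ← Fintype.sum_prod_type']
  exact ((Fin.consEquiv fun _ : Fin (n + 1) => Y).sum_comp F).symm

/-- Under a product distribution on `Yⁿ`, a function that changes by at most `1` when one
coordinate is changed has variance at most `n`. -/
theorem sum_prod_mul_sq_le (n : ℕ) (q : Fin n → Y → ℝ)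
    (hq : ∀ j, (∀ y, 0 ≤ q j y) ∧ ∑ y, q j y = 1) (f : (Fin n → Y) → ℝ)
    (hf : ∀ y j v, |f (Function.update y j v) - f y| ≤ 1) :
    ∑ y, (∏ j, q j (y j)) * f y ^ 2 ≤ (∑ y, (∏ j, q j (y j)) * f y) ^ 2 + n := by
  induction n with
  | zero => simp
  | succ n ih =>
    set g : (Fin n → Y) → ℝ := fun z => ∑ a, q 0 a * f (Fin.cons a z) with hg
    have hgf : ∀ z j v, |g (Function.update z j v) - g z| ≤ 1 := by
      intro z j v
      simp only [hg, ← Finset.sum_sub_distrib, ← mul_sub]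
      calc _ ≤ ∑ a, |q 0 a * (f (Fin.cons a (Function.update z j v)) - f (Fin.cons a z))| :=
            Finset.abs_sum_le_sum_abs _ _
        _ ≤ ∑ a, q 0 a := by
          refine Finset.sum_le_sum fun a _ => ?_
          rw [abs_mul, abs_of_nonneg ((hq 0).1 a), Fin.cons_update]
          exact mul_le_of_le_one_right ((hq 0).1 a) (hf _ _ _)
        _ = 1 := (hq 0).2
    have ih' := ih (fun j => q j.succ) (fun j => hq j.succ) g hgf
    have hmean : ∑ y, (∏ j, q j (y j)) * f y = ∑ z, (∏ j : Fin n, q j.succ (z j)) * g z := by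
      rw [sum_fin_succ_eq_sum_cons]
      refine Finset.sum_congr rfl fun z _ => ?_
      simp only [hg, Finset.mul_sum, Fin.prod_univ_succ, Fin.cons_zero, Fin.cons_succ]
      exact Finset.sum_congr rfl fun a _ => by ring
    have htot : ∑ z : Fin n → Y, ∏ j : Fin n, q j.succ (z j) = 1 := by
      rw [← Fintype.prod_sum]
      exact Finset.prod_eq_one fun j _ => (hq j.succ).2
    rw [hmean, sum_fin_succ_eq_sum_cons]
    calc _ ≤ ∑ z, (∏ j : Fin n, q j.succ (z j)) * (g z ^ 2 + 1) := by
          refine Finset.sum_le_sum fun z _ => ?_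
          simp only [Fin.prod_univ_succ, Fin.cons_zero, Fin.cons_succ]
          have : ∀ a, q 0 a * (∏ j : Fin n, q j.succ (z j)) * f (Fin.cons a z) ^ 2 =
              (∏ j : Fin n, q j.succ (z j)) * (q 0 a * f (Fin.cons a z) ^ 2) := by
            intro a; ring
          simp only [this, ← Finset.mul_sum]
          refine mul_le_mul_of_nonneg_left ?_ (Finset.prod_nonneg fun j _ => (hq j.succ).1 _)
          refine sum_mul_sq_le_sq_add_one (q 0) (hq 0).1 (hq 0).2 _ fun a b => ?_
          have := hf (Fin.cons b z) 0 a
          rwa [Fin.update_cons_zero] at this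
      _ = ∑ z, (∏ j : Fin n, q j.succ (z j)) * g z ^ 2 + 1 := by
          simp only [mul_add, mul_one, Finset.sum_add_distrib, htot]
      _ ≤ _ := by push_cast; linarith

/-- The Hamming neighbourhood of radius `r` of a set `B ⊆ Yⁿ`. -/
noncomputable def hammingThickening {n : ℕ} (r : ℝ) (B : Finset (Fin n → Y)) :
    Finset (Fin n → Y) :=
  B.biUnion fun b => Finset.univ.filter fun y => (hammingDist y b : ℝ) ≤ r

/-- Blowing-up: if `B` has probability at least `η` under a product distribution on `Yⁿ`, then its
Hamming neighbourhood of radius `2 r` has probability at least `1 - n / r²`,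
provided `n ≤ η r²`. -/
theorem one_sub_le_sum_hammingThickening {n : ℕ} (q : Fin n → Y → ℝ)
    (hq : ∀ j, (∀ y, 0 ≤ q j y) ∧ ∑ y, q j y = 1) {η r : ℝ} (hη : 0 < η) (hr : 0 < r)
    (hn : (n : ℝ) ≤ η * r ^ 2) (B : Finset (Fin n → Y))
    (hB : η ≤ ∑ y ∈ B, ∏ j, q j (y j)) :
    1 - n / r ^ 2 ≤ ∑ y ∈ hammingThickening (2 * r) B, ∏ j, q j (y j) := by
  have hne : B.Nonempty := by
    rw [Finset.nonempty_iff_ne_empty]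
    rintro rfl
    simp at hB
    linarith
  set P : (Fin n → Y) → ℝ := fun y => ∏ j, q j (y j) with hP
  have hP0 : ∀ y, 0 ≤ P y := fun y => Finset.prod_nonneg fun j _ => (hq j).1 _
  have hP1 : ∑ y, P y = 1 := by
    simp only [hP]
    rw [← Fintype.prod_sum]
    exact Finset.prod_eq_one fun j _ => (hq j).2
  let d : (Fin n → Y) → ℕ := fun y => B.inf' hne fun b => hammingDist y b
  have hd : ∀ y z, hammingDist y z ≤ 1 → d y ≤ d z + 1 := by
    intro y z hyz
    obtain ⟨b, hb, e⟩ := B.exists_mem_eq_inf' hne fun b => hammingDist z b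
    calc d y ≤ hammingDist y b := Finset.inf'_le _ hb
      _ ≤ hammingDist y z + hammingDist z b := hammingDist_triangle _ _ _
      _ ≤ d z + 1 := by
        have : d z = hammingDist z b := e
        omega
  have hup : ∀ (y : Fin n → Y) j v, hammingDist (Function.update y j v) y ≤ 1 := by
    intro y j v
    have : (Finset.univ.filter fun i => Function.update y j v i ≠ y i) ⊆ {j} := by
      intro i hi
      by_contra hij
      simp only [Finset.mem_singleton] at hij
      simp [Function.update_of_ne hij] at hi
    simpa [hammingDist] using Finset.card_le_card this
  have hvar := sum_prod_mul_sq_le n q hq (fun y => (d y : ℝ)) (by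
    intro y j v
    have h1 := hd _ _ (hup y j v)
    have h2 := hd _ _ ((hammingDist_comm _ _).trans_le (hup y j v))
    rw [abs_le]
    constructor
    · have : (d y : ℝ) ≤ d (Function.update y j v) + 1 := by exact_mod_cast h2
      linarith
    · have : (d (Function.update y j v) : ℝ) ≤ d y + 1 := by exact_mod_cast h1
      linarith)
  set m := ∑ y, P y * (d y : ℝ) with hm
  have hm0 : 0 ≤ m := Finset.sum_nonneg fun y _ => mul_nonneg (hP0 y) (Nat.cast_nonneg _)
  have hcent : ∑ y, P y * ((d y : ℝ) - m) ^ 2 ≤ n := by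
    have : ∀ y, P y * ((d y : ℝ) - m) ^ 2 =
        P y * (d y : ℝ) ^ 2 - 2 * m * (P y * d y) + m ^ 2 * P y := by
      intro y; ring
    simp only [this, Finset.sum_add_distrib, Finset.sum_sub_distrib, ← Finset.mul_sum, hP1, ← hm]
    linarith
  have cheb : ∀ (S : Finset (Fin n → Y)) (t : ℝ), (∀ y ∈ S, t ^ 2 ≤ ((d y : ℝ) - m) ^ 2) →
      (∑ y ∈ S, P y) * t ^ 2 ≤ n := by
    intro S t hS
    refine le_trans ?_ hcent
    rw [Finset.sum_mul]
    exact (Finset.sum_le_sum fun y hy => mul_le_mul_of_nonneg_left (hS y hy) (hP0 y)).trans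
      (Finset.sum_le_sum_of_subset_of_nonneg (Finset.subset_univ S)
        fun y _ _ => mul_nonneg (hP0 y) (sq_nonneg _))
  have hmr : m ≤ r := by
    have h1 : (∑ y ∈ B, P y) * m ^ 2 ≤ n := by
      refine cheb B m fun y hy => ?_
      have : d y = 0 := by
        have h := Finset.inf'_le (fun b => hammingDist y b) hy
        rw [hammingDist_self] at h
        exact Nat.le_zero.1 h
      simp [this]
    have h2 : η * m ^ 2 ≤ η * r ^ 2 :=
      ((mul_le_mul_of_nonneg_right hB (sq_nonneg m)).trans h1).trans hn
    exact (sq_le_sq₀ hm0 hr.le).1 (le_of_mul_le_mul_left h2 hη)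
  have hcompl : (∑ y ∈ (hammingThickening (2 * r) B)ᶜ, P y) * r ^ 2 ≤ n := by
    refine cheb _ r fun y hy => ?_
    obtain ⟨b, hb, e⟩ := B.exists_mem_eq_inf' hne fun b => hammingDist y b
    have hdy : 2 * r < d y := by
      by_contra! hle
      refine Finset.mem_compl.1 hy (Finset.mem_biUnion.2 ⟨b, hb, ?_⟩)
      simp only [Finset.mem_filter, Finset.mem_univ, true_and]
      rw [← e]
      exact hle
    exact pow_le_pow_left₀ hr.le (by linarith) 2
  have hsplit := Finset.sum_add_sum_compl (hammingThickening (2 * r) B) P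
  have : ∑ y ∈ (hammingThickening (2 * r) B)ᶜ, P y ≤ n / r ^ 2 := by
    rwa [le_div_iff₀ (by positivity)]
  linarith

theorem card_hammingBall_mul_rpow_le {n : ℕ} (b : Fin n → Y) {s r : ℝ} (hs : 0 < s) (hs1 : s ≤ 1) :
    ((Finset.univ.filter fun y => (hammingDist y b : ℝ) ≤ r).card : ℝ) * s ^ r ≤
      (1 + Fintype.card Y * s) ^ n := by
  have hpow : ∀ y : Fin n → Y, s ^ hammingDist y b = ∏ j, if y j ≠ b j then s else 1 := by
    intro y
    rw [Finset.prod_ite]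
    simp [hammingDist]
  calc _ = ∑ y ∈ Finset.univ.filter fun y => (hammingDist y b : ℝ) ≤ r, s ^ r := by simp
    _ ≤ ∑ y ∈ Finset.univ.filter fun y => (hammingDist y b : ℝ) ≤ r, s ^ hammingDist y b := by
      refine Finset.sum_le_sum fun y hy => ?_
      rw [← Real.rpow_natCast]
      exact Real.rpow_le_rpow_of_exponent_ge hs hs1 (Finset.mem_filter.1 hy).2
    _ ≤ ∑ y, s ^ hammingDist y b :=
      Finset.sum_le_sum_of_subset_of_nonneg (Finset.filter_subset _ _) fun _ _ _ => by positivity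
    _ = ∏ j, ∑ v, if v ≠ b j then s else 1 := by
      simp only [hpow]
      rw [Fintype.prod_sum]
    _ ≤ ∏ _j : Fin n, (1 + Fintype.card Y * s) := by
      refine Finset.prod_le_prod (fun j _ => Finset.sum_nonneg fun v _ => ?_) fun j _ => ?_
      · split_ifs <;> linarith
      · calc ∑ v, (if v ≠ b j then s else 1) ≤ ∑ v, ((if v = b j then 1 else 0) + s) := by
              refine Finset.sum_le_sum fun v _ => ?_
              by_cases h : v = b j <;> simp [h, hs.le]
          _ = 1 + Fintype.card Y * s := by
              simp [Finset.sum_add_distrib]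
    _ = _ := by simp

theorem card_hammingThickening_mul_rpow_le {n : ℕ} (B : Finset (Fin n → Y)) {s r : ℝ}
    (hs : 0 < s) (hs1 : s ≤ 1) :
    ((hammingThickening r B).card : ℝ) * s ^ r ≤ B.card * (1 + Fintype.card Y * s) ^ n := by
  have h : ((hammingThickening r B).card : ℝ) ≤
      ∑ b ∈ B, ((Finset.univ.filter fun y => (hammingDist y b : ℝ) ≤ r).card : ℝ) := by
    exact_mod_cast Finset.card_biUnion_le
  calc _ ≤ _ := mul_le_mul_of_nonneg_right h (by positivity)
    _ ≤ ∑ b ∈ B, (1 + Fintype.card Y * s) ^ n := by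
      rw [Finset.sum_mul]
      exact Finset.sum_le_sum fun b _ => card_hammingBall_mul_rpow_le b hs hs1
    _ = _ := by simp

/-- For every `δ ∈ (0, 1)` there is a relative radius `γ > 0` such that Hamming neighbourhoods of
radius `γ n` in `Yⁿ` are at most `2 ^ (2 n δ)` times larger than the original set. -/
theorem exists_card_hammingThickening_le (Y : Type*) [Fintype Y] [Nonempty Y] {δ : ℝ} (hδ0 : 0 < δ)
    (hδ1 : δ < 1) : ∃ γ : ℝ, 0 < γ ∧ ∀ (n : ℕ) (B : Finset (Fin n → Y)),
      ((hammingThickening (γ * n) B).card : ℝ) ≤ B.card * (2 : ℝ) ^ (2 * n * δ) := by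
  have hc : (1 : ℝ) ≤ Fintype.card Y := by exact_mod_cast Fintype.card_pos
  have h2 : (1 : ℝ) < 2 ^ δ := Real.one_lt_rpow one_lt_two hδ0
  have h3 : (2 : ℝ) ^ δ < 2 := by
    simpa using Real.rpow_lt_rpow_of_exponent_lt one_lt_two hδ1
  set s : ℝ := ((2 : ℝ) ^ δ - 1) / Fintype.card Y with hs
  have hs0 : 0 < s := div_pos (by linarith) (by linarith)
  have hs1 : s ≤ 1 := by
    rw [hs, div_le_one (by linarith)]
    linarith
  have hcs : 1 + Fintype.card Y * s = (2 : ℝ) ^ δ := by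
    rw [hs]
    field_simp
    ring
  have hL : 0 ≤ -Real.logb 2 s := by
    have := Real.logb_nonpos one_lt_two hs0.le hs1
    linarith
  refine ⟨δ / (1 - Real.logb 2 s), div_pos hδ0 (by linarith), fun n B => ?_⟩
  have key := card_hammingThickening_mul_rpow_le B (r := δ / (1 - Real.logb 2 s) * n) hs0 hs1
  rw [hcs, ← Real.rpow_mul_natCast zero_le_two] at key
  have hsp : (2 : ℝ) ^ (-(δ * n)) ≤ s ^ (δ / (1 - Real.logb 2 s) * n) := by
    have hsr : ∀ t, s ^ t = (2 : ℝ) ^ (Real.logb 2 s * t) := fun t => by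
      rw [Real.rpow_mul zero_le_two, Real.rpow_logb two_pos (by norm_num) hs0]
    rw [hsr]
    refine Real.rpow_le_rpow_of_exponent_le one_le_two ?_
    have h : -Real.logb 2 s / (1 - Real.logb 2 s) ≤ 1 := by
      rw [div_le_one (by linarith)]
      linarith
    have h' := mul_le_mul_of_nonneg_left h (show 0 ≤ δ * n by positivity)
    have e : Real.logb 2 s * (δ / (1 - Real.logb 2 s) * n) =
        -(δ * n * (-Real.logb 2 s / (1 - Real.logb 2 s))) := by ring
    rw [e]
    linarith
  have h4 := (mul_le_mul_of_nonneg_left hsp (Nat.cast_nonneg _)).trans key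
  have e1 : (2 : ℝ) ^ (-(δ * n)) * 2 ^ (δ * n) = 1 := by
    rw [← Real.rpow_add two_pos]
    simp
  have e2 : (2 : ℝ) ^ (2 * n * δ) = 2 ^ (δ * n) * 2 ^ (δ * n) := by
    rw [← Real.rpow_add two_pos]
    congr 1
    ring
  calc _ = ((hammingThickening (δ / (1 - Real.logb 2 s) * n) B).card : ℝ) *
        2 ^ (-(δ * n)) * 2 ^ (δ * n) := by rw [mul_assoc, e1, mul_one]
    _ ≤ B.card * 2 ^ (δ * n) * 2 ^ (δ * n) := mul_le_mul_of_nonneg_right h4 (by positivity)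
    _ = _ := by rw [e2, mul_assoc]

end Concentration

section Entropy

variable {Z : Type*} [Fintype Z]

theorem one_sub_mul_le_ent (q : Z → ℝ) (hq0 : ∀ z, 0 ≤ q z) (hq1 : ∀ z, q z ≤ 1) (S : Finset Z)
    {c η : ℝ} (hη : η ≤ 1) (hS : ∀ z ∈ S, q z ≤ 2 ^ (-c)) (hqS : 1 - η ≤ ∑ z ∈ S, q z) :
    (1 - η) * c ≤ ent q := by
  have hterm : ∀ z, 0 ≤ -(q z * Real.logb 2 (q z)) := fun z => by
    have := mul_nonneg (hq0 z) (neg_nonneg.2 (Real.logb_nonpos one_lt_two (hq0 z) (hq1 z)))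
    linarith
  have hent : ent q = ∑ z, -(q z * Real.logb 2 (q z)) := by
    rw [ent, Finset.sum_neg_distrib]
  rw [hent]
  rcases le_total c 0 with hc | hc
  · exact (mul_nonpos_of_nonneg_of_nonpos (by linarith) hc).trans
      (Finset.sum_nonneg fun z _ => hterm z)
  calc (1 - η) * c ≤ (∑ z ∈ S, q z) * c := mul_le_mul_of_nonneg_right hqS hc
    _ ≤ ∑ z ∈ S, -(q z * Real.logb 2 (q z)) := by
      rw [Finset.sum_mul]
      refine Finset.sum_le_sum fun z hz => ?_
      rcases (hq0 z).eq_or_lt with h | h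
      · simp [← h]
      · have : Real.logb 2 (q z) ≤ -c := (Real.logb_le_iff_le_rpow one_lt_two h).2 (hS z hz)
        nlinarith
    _ ≤ _ := Finset.sum_le_sum_of_subset_of_nonneg (Finset.subset_univ S) fun z _ _ => hterm z

end Entropy

section Channel

variable {X Y : Type*} {W : X → Y → ℝ} {n : ℕ}

theorem sum_outDist (A : Finset (Fin n → X)) (S : Finset (Fin n → Y)) :
    ∑ y ∈ S, outDist W A y = (A.card : ℝ)⁻¹ * ∑ x ∈ A, prodWSet W x S := by
  simp only [outDist, prodWSet, ← Finset.mul_sum]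
  rw [Finset.sum_comm]

theorem le_sum_outDist {A : Finset (Fin n → X)} (hA : A.Nonempty) {S : Finset (Fin n → Y)} {t : ℝ}
    (h : ∀ x ∈ A, t ≤ prodWSet W x S) : t ≤ ∑ y ∈ S, outDist W A y := by
  have hc : (0 : ℝ) < A.card := by exact_mod_cast hA.card_pos
  rw [sum_outDist, inv_mul_eq_div, le_div_iff₀ hc, mul_comm]
  simpa using Finset.sum_le_sum h

variable [Fintype Y]

theorem prodW_nonneg (hW : isChannel W) (x : Fin n → X) (y : Fin n → Y) : 0 ≤ prodW W x y :=
  Finset.prod_nonneg fun j _ => (hW (x j)).1 _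

theorem prodWSet_univ (hW : isChannel W) (x : Fin n → X) : prodWSet W x Finset.univ = 1 := by
  unfold prodWSet prodW
  rw [← Fintype.prod_sum]
  exact Finset.prod_eq_one fun j _ => (hW (x j)).2

theorem outDist_nonneg (hW : isChannel W) (A : Finset (Fin n → X)) (y : Fin n → Y) :
    0 ≤ outDist W A y :=
  mul_nonneg (by positivity) (Finset.sum_nonneg fun x _ => prodW_nonneg hW x y)

theorem sum_outDist_univ (hW : isChannel W) {A : Finset (Fin n → X)} (hA : A.Nonempty) :
    ∑ y, outDist W A y = 1 := by
  have : (A.card : ℝ) ≠ 0 := by exact_mod_cast hA.card_pos.ne'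
  simp [sum_outDist, prodWSet_univ hW, this]

theorem outDist_le_one (hW : isChannel W) {A : Finset (Fin n → X)} (hA : A.Nonempty)
    (y : Fin n → Y) : outDist W A y ≤ 1 := by
  rw [← sum_outDist_univ hW hA]
  exact Finset.single_le_sum (fun y _ => outDist_nonneg hW A y) (Finset.mem_univ y)

theorem outDist_le_mul_outDist (hW : isChannel W) {A' A : Finset (Fin n → X)} (hsub : A' ⊆ A)
    (hA' : A'.Nonempty) {M : ℝ} (hM : (A.card : ℝ) ≤ M * A'.card) (y : Fin n → Y) :
    outDist W A' y ≤ M * outDist W A y := by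
  have h' : (0 : ℝ) < A'.card := by exact_mod_cast hA'.card_pos
  have h : (0 : ℝ) < A.card := by exact_mod_cast (hA'.mono hsub).card_pos
  unfold outDist
  rw [← mul_assoc]
  refine mul_le_mul ?_ (Finset.sum_le_sum_of_subset_of_nonneg hsub
    fun x _ _ => prodW_nonneg hW x y) (Finset.sum_nonneg fun x _ => prodW_nonneg hW x y) ?_
  · rw [← div_eq_mul_inv, inv_eq_one_div, div_le_div_iff₀ h' h]
    linarith
  · have : 0 < M := pos_of_mul_pos_left (h.trans_le hM) h'.le
    positivity

theorem prodWSet_compl (hW : isChannel W) (x : Fin n → X) (S : Finset (Fin n → Y)) :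
    prodWSet W x Sᶜ = 1 - prodWSet W x S := by
  rw [← prodWSet_univ hW x]
  unfold prodWSet
  rw [← Finset.sum_add_sum_compl S]
  ring

theorem prodWSet_mono (hW : isChannel W) (x : Fin n → X) {S T : Finset (Fin n → Y)} (h : S ⊆ T) :
    prodWSet W x S ≤ prodWSet W x T :=
  Finset.sum_le_sum_of_subset_of_nonneg h fun y _ _ => prodW_nonneg hW x y

theorem gimg_le_card {A : Finset (Fin n → X)} {B : Finset (Fin n → Y)} {η : ℝ}
    (h : ∀ x ∈ A, η ≤ prodWSet W x B) : gimg W A η ≤ B.card :=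
  Nat.sInf_le ⟨B, rfl, h⟩

theorem logb_gimg_le {A : Finset (Fin n → X)} {B : Finset (Fin n → Y)} {η t : ℝ} (ht : 0 ≤ t)
    (h : ∀ x ∈ A, η ≤ prodWSet W x B) (hB : (B.card : ℝ) ≤ 2 ^ t) :
    Real.logb 2 (gimg W A η) ≤ t := by
  rcases (gimg W A η).eq_zero_or_pos with h0 | h0
  · simpa [h0] using ht
  · rw [Real.logb_le_iff_le_rpow one_lt_two (by exact_mod_cast h0)]
    exact le_trans (by exact_mod_cast gimg_le_card h) hB

/-- The outputs in the first `k + 1` levels of the `δ`-information spectrum of `p`; for `k = K`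
this is the whole output space. -/
noncomputable def spectrumLower (p : (Fin n → Y) → ℝ) (δ : ℝ) (K k : ℕ) : Finset (Fin n → Y) :=
  Finset.univ.filter fun y => k < K → (2 : ℝ) ^ (-(n * ((k : ℝ) + 1) * δ)) < p y

theorem card_spectrumLower_le [Nonempty Y] {p : (Fin n → Y) → ℝ} (hp0 : ∀ y, 0 ≤ p y)
    (hp : ∑ y, p y = 1) {δ : ℝ} {K : ℕ} (hδ : 0 < δ)
    (hK : Real.logb 2 (Fintype.card Y) ≤ K * δ) {k : ℕ} (hk : k ≤ K) :
    ((spectrumLower p δ K k).card : ℝ) ≤ 2 ^ (n * ((k : ℝ) + 1) * δ) := by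
  rcases hk.eq_or_lt with rfl | hk
  · have hY : (0 : ℝ) < Fintype.card Y := by exact_mod_cast Fintype.card_pos
    calc ((spectrumLower p δ k k).card : ℝ) ≤ (Fintype.card Y : ℝ) ^ n := by
          have := Finset.card_le_univ (spectrumLower p δ k k)
          rw [Fintype.card_fun, Fintype.card_fin] at this
          exact_mod_cast this
      _ = 2 ^ (Real.logb 2 (Fintype.card Y) * n) := by
          rw [Real.rpow_mul_natCast zero_le_two, Real.rpow_logb two_pos (by norm_num) hY]
      _ ≤ _ := by
          refine Real.rpow_le_rpow_of_exponent_le one_le_two ?_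
          have h := mul_le_mul_of_nonneg_left hK (Nat.cast_nonneg (α := ℝ) n)
          have h' : 0 ≤ (n : ℝ) * δ := by positivity
          nlinarith
  · have h : ((spectrumLower p δ K k).card : ℝ) * 2 ^ (-(n * ((k : ℝ) + 1) * δ)) ≤ 1 := by
      rw [← nsmul_eq_mul, ← Finset.sum_const]
      refine le_trans ?_ hp.le
      exact (Finset.sum_le_sum fun y hy => ((Finset.mem_filter.1 hy).2 hk).le).trans
        (Finset.sum_le_sum_of_subset_of_nonneg (Finset.subset_univ _) fun y _ _ => hp0 y)
    rwa [Real.rpow_neg zero_le_two, ← div_eq_mul_inv, div_le_one (by positivity)] at h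

/-- Every input set has a subset of proportion at least `1 / (K + 1)` and a level `k` such that
the lower part of the information spectrum up to level `k` is an `η`-image of the subset, while the
outputs of information density at least `k δ` carry conditional probability `1 - η`. -/
theorem exists_subset_spectrum_level (hW : isChannel W) {A : Finset (Fin n → X)}
    (hA : A.Nonempty) (δ : ℝ) (K : ℕ) {η : ℝ} (hη0 : 0 ≤ η) (hη1 : η ≤ 1) :
    ∃ A' ⊆ A, A'.Nonempty ∧ (A.card : ℝ) ≤ (K + 1) * A'.card ∧ ∃ k ≤ K,
      (∀ x ∈ A', η ≤ prodWSet W x (spectrumLower (outDist W A) δ K k)) ∧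
      ∀ x ∈ A', 1 - η ≤ prodWSet W x
        (Finset.univ.filter fun y => outDist W A y ≤ 2 ^ (-(n * (k : ℝ) * δ))) := by
  set p := outDist W A with hp
  have hex : ∀ x : Fin n → X, ∃ k, η ≤ prodWSet W x (spectrumLower p δ K k) := fun x =>
    ⟨K, by simpa [spectrumLower, prodWSet_univ hW] using hη1⟩
  let κ : (Fin n → X) → ℕ := fun x => Nat.find (hex x)
  have hκK : ∀ x, κ x ≤ K := fun x =>
    Nat.find_min' (hex x) (by simpa [spectrumLower, prodWSet_univ hW] using hη1)
  obtain ⟨k, hk, hcard⟩ : ∃ k ∈ Finset.range (K + 1),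
      (A.card : ℝ) ≤ (K + 1) * (A.filter fun x => κ x = k).card := by
    by_contra! hlt
    have hsum : (A.card : ℝ) =
        ∑ k ∈ Finset.range (K + 1), ((A.filter fun x => κ x = k).card : ℝ) := by
      exact_mod_cast Finset.card_eq_sum_card_fiberwise fun x _ => by
        simpa [Nat.lt_succ_iff] using hκK x
    have := Finset.sum_lt_sum_of_nonempty Finset.nonempty_range_add_one hlt
    rw [← Finset.mul_sum, ← hsum] at this
    simp at this
  have hA0 : (0 : ℝ) < A.card := by exact_mod_cast hA.card_pos
  refine ⟨A.filter fun x => κ x = k, Finset.filter_subset _ _, ?_, hcard, k,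
    Nat.lt_succ_iff.1 (Finset.mem_range.1 hk), ?_, ?_⟩
  · rw [Finset.nonempty_iff_ne_empty]
    intro h
    rw [h] at hcard
    simp at hcard
    exact hA.ne_empty hcard
  · intro x hx
    rw [← (Finset.mem_filter.1 hx).2]
    exact Nat.find_spec (hex x)
  · intro x hx
    have hxk : κ x = k := (Finset.mem_filter.1 hx).2
    rcases k with _ | k
    · have : (Finset.univ.filter fun y => p y ≤ 2 ^ (-(n * ((0 : ℕ) : ℝ) * δ))) =
          Finset.univ := by
        refine Finset.filter_true_of_mem fun y _ => ?_
        simpa using outDist_le_one hW hA y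
      rw [this, prodWSet_univ hW]
      linarith
    · have hmin : prodWSet W x (spectrumLower p δ K k) < η :=
        not_le.1 (Nat.find_min (hex x) (m := k) (by
          have : Nat.find (hex x) = k + 1 := hxk
          omega))
      have hc := prodWSet_compl hW x (spectrumLower p δ K k)
      refine le_trans (b := prodWSet W x (spectrumLower p δ K k)ᶜ) (by linarith)
        (prodWSet_mono hW x fun y hy => ?_)
      simp only [spectrumLower, Finset.mem_compl, Finset.mem_filter, Finset.mem_univ, true_and,
        Classical.not_imp, not_lt] at hy
      simpa using hy.2

end Channel

open Filter in
/-- Lemma 5: there are `ε_n → 0` and `β_n → 1`, independent of the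
input set, such that eventually every nonempty `A` contains a nonempty `A*` with
`|A*|/|A| ≥ 1/(2(K_δ+1))` and
`(1/n) H(P_{A*}) ≥ (1/n) log₂ gⁿ(A*, β_n) - 7.19 δ - ε_n`. -/
theorem stmt_8 {X Y : Type*} [Fintype X] [Fintype Y] [Nonempty X] [Nonempty Y]
    (W : X → Y → ℝ) (hW : isChannel W)
    (δ : ℝ) (hδ : δ ∈ Set.Ioo (0:ℝ) 1)
    (K : ℕ) (hK : K = Kdel (Fintype.card Y) δ) :
    ∃ ε β : ℕ → ℝ,
      (∀ n, 0 ≤ ε n) ∧ Tendsto ε atTop (nhds 0) ∧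
      (∀ n, β n ∈ Set.Ioo (0:ℝ) 1) ∧ Tendsto β atTop (nhds 1) ∧
      ∃ N : ℕ, ∀ n : ℕ, N ≤ n → ∀ A : Finset (Fin n → X), A.Nonempty →
        ∃ Astar : Finset (Fin n → X), Astar ⊆ A ∧ Astar.Nonempty ∧
          1 / (2 * ((K:ℝ) + 1)) ≤ (Astar.card : ℝ) / (A.card : ℝ) ∧
          (1 / (n:ℝ)) * ent (outDist W Astar) ≥
            (1 / (n:ℝ)) * Real.logb 2 (gimg W Astar (β n)) - 7.19 * δ - ε n := by
  obtain ⟨hδ0, hδ1⟩ := hδ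
  have hKl : Real.logb 2 (Fintype.card Y) ≤ K * δ := by
    rw [hK, Kdel, ← div_le_iff₀ hδ0]
    exact Nat.le_ceil _
  obtain ⟨γ, hγ, hthick⟩ := exists_card_hammingThickening_le Y hδ0 hδ1
  set η : ℝ := 1 / (K + 1) with hη
  have hη0 : 0 < η := by positivity
  have hη1 : η ≤ 1 := by
    rw [hη, div_le_one (by positivity)]
    linarith [Nat.cast_nonneg (α := ℝ) K]
  set C : ℝ := 8 / γ ^ 2 with hC
  have hC0 : 0 < C := by positivity
  refine ⟨fun _ => 0, fun n => 1 - C / (n + C + 1), fun _ => le_rfl, tendsto_const_nhds, ?_, ?_, ?_⟩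
  · intro n
    have h1 : C / (n + C + 1) < 1 := by
      rw [div_lt_one (by positivity)]
      linarith [Nat.cast_nonneg (α := ℝ) n]
    have h2 : 0 < C / (n + C + 1) := by positivity
    constructor <;> linarith
  · have h : Tendsto (fun n : ℕ => C / ((n : ℝ) + C + 1)) atTop (nhds 0) := by
      refine Tendsto.div_atTop tendsto_const_nhds ?_
      exact tendsto_atTop_add_const_right _ _
        (tendsto_atTop_add_const_right _ _ tendsto_natCast_atTop_atTop)
    simpa using h.const_sub 1
  obtain ⟨N, hN⟩ := exists_nat_ge (1 + (C + 1) + Real.logb 2 (K + 1) / δ + 4 / (η * γ ^ 2))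
  refine ⟨N, fun n hn A hA => ?_⟩
  have hlog0 : 0 ≤ Real.logb 2 ((K : ℝ) + 1) :=
    Real.logb_nonneg one_lt_two (by linarith [Nat.cast_nonneg (α := ℝ) K])
  have hn' : 1 + (C + 1) + Real.logb 2 (K + 1) / δ + 4 / (η * γ ^ 2) ≤ (n : ℝ) :=
    hN.trans (by exact_mod_cast hn)
  have t1 : 0 ≤ Real.logb 2 ((K : ℝ) + 1) / δ := by positivity
  have t2 : 0 < 4 / (η * γ ^ 2) := by positivity
  have hn1 : (0 : ℝ) < n := by linarith
  have hnlog : Real.logb 2 ((K : ℝ) + 1) ≤ n * δ := by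
    rw [← div_le_iff₀ hδ0]
    linarith
  have hnη : (n : ℝ) ≤ η * (γ * n / 2) ^ 2 := by
    have h : 4 / (η * γ ^ 2) ≤ n := by linarith
    rw [div_le_iff₀ (by positivity)] at h
    nlinarith
  have hβ : 1 - C / (n + C + 1) ≤ 1 - n / (γ * n / 2) ^ 2 := by
    have e : (n : ℝ) / (γ * n / 2) ^ 2 = C / (2 * n) := by
      rw [hC]
      field_simp
      norm_num
    rw [e]
    have : C / (2 * n) ≤ C / (n + C + 1) :=
      div_le_div_of_nonneg_left hC0.le (by positivity) (by linarith)
    linarith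
  obtain ⟨A', hsub, hne, hcard, k, hk, himg, hlow⟩ :=
    exists_subset_spectrum_level hW hA δ K hη0.le hη1
  have hA0 : (0 : ℝ) < A.card := by exact_mod_cast hA.card_pos
  have hK0 : (0 : ℝ) < K + 1 := by positivity
  refine ⟨A', hsub, hne, ?_, ?_⟩
  · rw [div_le_div_iff₀ (by positivity) hA0]
    nlinarith [Nat.cast_nonneg (α := ℝ) A'.card]
  have hg : Real.logb 2 (gimg W A' (1 - C / (n + C + 1))) ≤ n * ((k : ℝ) + 1) * δ + 2 * n * δ := by
    refine logb_gimg_le (by positivity)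
      (B := hammingThickening (γ * n) (spectrumLower (outDist W A) δ K k)) (fun x hx => ?_) ?_
    · have h := one_sub_le_sum_hammingThickening (fun j => W (x j)) (fun j => hW (x j)) hη0
        (r := γ * n / 2) (by positivity) hnη _ (himg x hx)
      rw [mul_div_cancel₀ _ two_ne_zero] at h
      exact hβ.trans h
    · refine (hthick n _).trans ?_
      rw [Real.rpow_add two_pos]
      exact mul_le_mul_of_nonneg_right (card_spectrumLower_le (outDist_nonneg hW A)
        (sum_outDist_univ hW hA) hδ0 hKl hk) (by positivity)
  have hent := one_sub_mul_le_ent (outDist W A') (outDist_nonneg hW A') (outDist_le_one hW hne)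
    (Finset.univ.filter fun y => outDist W A y ≤ 2 ^ (-(n * (k : ℝ) * δ)))
    (c := n * k * δ - Real.logb 2 (K + 1)) hη1 (fun y hy => by
      refine (outDist_le_mul_outDist hW hsub hne hcard y).trans ?_
      rw [neg_sub, sub_eq_add_neg, Real.rpow_add two_pos,
        Real.rpow_logb two_pos (by norm_num) hK0]
      exact mul_le_mul_of_nonneg_left (Finset.mem_filter.1 hy).2 hK0.le)
    (le_sum_outDist hne hlow)
  have hηk : η * (n * k * δ) ≤ n * δ := by
    have h1 : η * k ≤ 1 := by
      rw [hη, one_div_mul_eq_div, div_le_one hK0]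
      have : (k : ℝ) ≤ K := by exact_mod_cast hk
      linarith
    have h2 := mul_le_mul_of_nonneg_right h1 (show 0 ≤ (n : ℝ) * δ by positivity)
    linarith
  have hfin : Real.logb 2 (gimg W A' (1 - C / (n + C + 1))) - 7.19 * δ * n ≤
      ent (outDist W A') := by
    have h3 : 0 ≤ (n : ℝ) * δ := by positivity
    have h4 : 0 ≤ η * Real.logb 2 ((K : ℝ) + 1) := by positivity
    linarith
  have h5 := mul_le_mul_of_nonneg_left hfin (show 0 ≤ 1 / (n : ℝ) by positivity)
  have e : 1 / (n : ℝ) * (Real.logb 2 (gimg W A' (1 - C / (n + C + 1))) - 7.19 * δ * n) =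
      1 / (n : ℝ) * Real.logb 2 (gimg W A' (1 - C / (n + C + 1))) - 7.19 * δ := by
    field_simp
  rw [e] at h5
  simpa using h5
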